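/- Weak converse and cardinality bound for the bidirectional broadcast channel: let W : 𝒳 → PMF(𝒴₁ × 𝒴₂) be a discrete memoryless broadcast channel and let (R₂, R₁) be an achievable rate pair, i.e. for every δ > 0 there exist n(δ) ∈ ℕ and a sequence of (M₁⁽ⁿ⁾, M₂⁽ⁿ⁾, n)-codes such that (log M₁⁽ⁿ⁾)/n ≥ R₂ − δ and (log M₂⁽ⁿ⁾)/n ≥ R₁ − δ for all n ≥ n(δ), while λ₁⁽ⁿ⁾ → 0 and λ₂⁽ⁿ⁾ → 0 as n → ∞. Then (R₂, R₁) belongs to the information region 𝒞 of W, and moreover the auxiliary alphabet in the definition of 𝒞 can be taken to be U = Fin 2, i.e. there is a PMF q on (Fin 2) × 𝒳 with R₂ ≤ I(X; Y₂ | U) and R₁ ≤ I(X; Y₁ | U) for the induced joint law. -/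

import Mathlib

open scoped Classical BigOperators

noncomputable section

namespace BDBC

/-- A `(M₁, M₂, n)`-code for the bidirectional broadcast channel: an encoder at the
relay node and a decoder at each of the two receiving nodes (which know their own
message as side information); `none` plays the role of an erasure symbol. -/
structure Code (𝒳 𝒴₁ 𝒴₂ : Type) (M₁ M₂ n : ℕ) where
  enc : Fin M₁ × Fin M₂ → Fin n → 𝒳
  dec₁ : (Fin n → 𝒴₁) × Fin M₁ → Option (Fin M₂)
  dec₂ : (Fin n → 𝒴₂) × Fin M₂ → Option (Fin M₁)

variable {𝒳 𝒴₁ 𝒴₂ : Type}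

/-- Probability of the event `E` under the `n`-fold memoryless extension of the
broadcast channel `W` with input word `x`. -/
def prodProb [Fintype 𝒴₁] [Fintype 𝒴₂] (W : 𝒳 → PMF (𝒴₁ × 𝒴₂)) {n : ℕ}
    (x : Fin n → 𝒳) (E : (Fin n → 𝒴₁ × 𝒴₂) → Prop) : ℝ :=
  ∑ y ∈ Finset.univ.filter E, ∏ i, ((W (x i)) (y i)).toReal

/-- Error probability `λ₁(w₁,w₂)` at node 1 (which knows `w₁` and decodes `w₂`). -/
def err₁ [Fintype 𝒴₁] [Fintype 𝒴₂] (W : 𝒳 → PMF (𝒴₁ × 𝒴₂)) {M₁ M₂ n : ℕ}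
    (c : Code 𝒳 𝒴₁ 𝒴₂ M₁ M₂ n) (v : Fin M₁ × Fin M₂) : ℝ :=
  prodProb W (c.enc v) (fun y => c.dec₁ (fun i => (y i).1, v.1) ≠ some v.2)

/-- Error probability `λ₂(w₁,w₂)` at node 2 (which knows `w₂` and decodes `w₁`). -/
def err₂ [Fintype 𝒴₁] [Fintype 𝒴₂] (W : 𝒳 → PMF (𝒴₁ × 𝒴₂)) {M₁ M₂ n : ℕ}
    (c : Code 𝒳 𝒴₁ 𝒴₂ M₁ M₂ n) (v : Fin M₁ × Fin M₂) : ℝ :=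
  prodProb W (c.enc v) (fun y => c.dec₂ (fun i => (y i).2, v.2) ≠ some v.1)

/-- Maximum error probability at node `k`. -/
def maxErr₁ [Fintype 𝒴₁] [Fintype 𝒴₂] (W : 𝒳 → PMF (𝒴₁ × 𝒴₂)) {M₁ M₂ n : ℕ}
    (c : Code 𝒳 𝒴₁ 𝒴₂ M₁ M₂ n) : ℝ :=
  ⨆ v : Fin M₁ × Fin M₂, err₁ W c v

def maxErr₂ [Fintype 𝒴₁] [Fintype 𝒴₂] (W : 𝒳 → PMF (𝒴₁ × 𝒴₂)) {M₁ M₂ n : ℕ}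
    (c : Code 𝒳 𝒴₁ 𝒴₂ M₁ M₂ n) : ℝ :=
  ⨆ v : Fin M₁ × Fin M₂, err₂ W c v

/-- Average error probability at node `k`. -/
def avgErr₁ [Fintype 𝒴₁] [Fintype 𝒴₂] (W : 𝒳 → PMF (𝒴₁ × 𝒴₂)) {M₁ M₂ n : ℕ}
    (c : Code 𝒳 𝒴₁ 𝒴₂ M₁ M₂ n) : ℝ :=
  (∑ v : Fin M₁ × Fin M₂, err₁ W c v) / (M₁ * M₂)

def avgErr₂ [Fintype 𝒴₁] [Fintype 𝒴₂] (W : 𝒳 → PMF (𝒴₁ × 𝒴₂)) {M₁ M₂ n : ℕ}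
    (c : Code 𝒳 𝒴₁ 𝒴₂ M₁ M₂ n) : ℝ :=
  (∑ v : Fin M₁ × Fin M₂, err₂ W c v) / (M₁ * M₂)

/-- Shannon entropy (in nats) of a PMF on a finite type. -/
def pmfEntropy {α : Type} [Fintype α] (p : PMF α) : ℝ :=
  ∑ a : α, Real.negMulLog (p a).toReal

/-- Conditional mutual information `I(X;Y|U)` (in nats) computed from the joint law of
`(U, X, Y)` via `I(X;Y|U) = H(U,X) + H(U,Y) - H(U) - H(U,X,Y)`. -/
def condMI {U 𝒳' Y : Type} [Fintype U] [Fintype 𝒳'] [Fintype Y]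
    (p : PMF (U × 𝒳' × Y)) : ℝ :=
  pmfEntropy (p.map fun z => (z.1, z.2.1)) + pmfEntropy (p.map fun z => (z.1, z.2.2))
    - pmfEntropy (p.map Prod.fst) - pmfEntropy p

/-- Joint law of `(U, X, Y₁)` obtained by sampling `(u,x)` from `q` and `(y₁,y₂)` from `W x`. -/
def joint₁ {U : Type} (W : 𝒳 → PMF (𝒴₁ × 𝒴₂)) (q : PMF (U × 𝒳)) : PMF (U × 𝒳 × 𝒴₁) :=
  q.bind fun ux => (W ux.2).map fun y => (ux.1, ux.2, y.1)

/-- Joint law of `(U, X, Y₂)`. -/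
def joint₂ {U : Type} (W : 𝒳 → PMF (𝒴₁ × 𝒴₂)) (q : PMF (U × 𝒳)) : PMF (U × 𝒳 × 𝒴₂) :=
  q.bind fun ux => (W ux.2).map fun y => (ux.1, ux.2, y.2)

/-- The information region `𝒞` of the bidirectional broadcast channel `W`: pairs
`(R₂, R₁)` of nonnegative reals with `R₂ ≤ I(X;Y₂|U)` and `R₁ ≤ I(X;Y₁|U)` for some
finite auxiliary type `U` and input distribution `q` on `U × 𝒳`. -/
def infoRegion [Fintype 𝒳] [Fintype 𝒴₁] [Fintype 𝒴₂] (W : 𝒳 → PMF (𝒴₁ × 𝒴₂)) :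
    Set (ℝ × ℝ) :=
  {R | 0 ≤ R.1 ∧ 0 ≤ R.2 ∧
    ∃ (U : Type) (iU : Fintype U) (q : PMF (U × 𝒳)),
      haveI := iU
      R.1 ≤ condMI (joint₂ W q) ∧ R.2 ≤ condMI (joint₁ W q)}

/-- Mutual information between the input and the output of the channel `V`, for the input
weights `p`, as output entropy minus conditional entropy of the output given the input. -/
def mutualInfo {X Y : Type} [Fintype X] [Fintype Y] (V : X → PMF Y) (p : X → ℝ) : ℝ :=
  ∑ y, Real.negMulLog (∑ x, p x * (V x y).toReal) - ∑ x, p x * pmfEntropy (V x)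

/-- The fraction of positions, over all messages `s` and times `i`, at which the codeword
letter equals `x`. -/
def letterFreq {S X : Type} [Fintype S] {n : ℕ} (enc : S → Fin n → X) (x : X) : ℝ :=
  (∑ s, ∑ i, if enc s i = x then 1 else 0) / (Fintype.card S * n)

section FiniteSums

lemma sum_toReal_pmf {α : Type} [Fintype α] (p : PMF α) : ∑ a, (p a).toReal = 1 := by
  rw [← ENNReal.toReal_sum (fun a _ => p.apply_ne_top a), ← tsum_fintype (L := .unconditional _),
    p.tsum_coe, ENNReal.toReal_one]

lemma toReal_map_apply {α β : Type} [Fintype α] (p : PMF α) (φ : α → β) (b : β) :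
    ((p.map φ) b).toReal = ∑ a with φ a = b, (p a).toReal := by
  rw [PMF.map_apply, tsum_fintype, ENNReal.toReal_sum, Finset.sum_filter]
  · refine Finset.sum_congr rfl fun a _ => ?_
    by_cases h : φ a = b
    · simp [h]
    · simp [h, Ne.symm h]
  · intro a _
    split_ifs
    · exact p.apply_ne_top a
    · simp

lemma sum_prod_eq_one {Y : Type} [Fintype Y] {n : ℕ} (v : Fin n → Y → ℝ)
    (hv : ∀ i, ∑ y, v i y = 1) : ∑ z : Fin n → Y, ∏ i, v i (z i) = 1 := by
  have := Finset.prod_univ_sum (fun _ : Fin n => (Finset.univ : Finset Y)) v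
  rw [Fintype.piFinset_univ] at this
  rw [← this]
  simp [hv]

lemma sum_prod_mul_apply {Y : Type} [Fintype Y] {n : ℕ} (v : Fin n → Y → ℝ)
    (hv : ∀ i, ∑ y, v i y = 1) (i : Fin n) (g : Y → ℝ) :
    ∑ z : Fin n → Y, (∏ j, v j (z j)) * g (z i) = ∑ y, v i y * g y := by
  have := Finset.prod_univ_sum (fun _ : Fin n => (Finset.univ : Finset Y))
    (fun j y => v j y * if j = i then g y else 1)
  rw [Fintype.piFinset_univ, Finset.prod_eq_single i] at this
  · simp only [if_true] at this
    rw [this]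
    refine Finset.sum_congr rfl fun z _ => ?_
    rw [Finset.prod_mul_distrib]
    congr 1
    simp
  · intro j _ hj
    simp [hj, hv]
  · simp

lemma sum_prod_map {α Y : Type} [Fintype α] [Fintype Y] {n : ℕ} (p : Fin n → PMF α)
    (φ : α → Y) (E : (Fin n → Y) → Prop) :
    ∑ y : Fin n → α with E (fun i => φ (y i)), ∏ i, (p i (y i)).toReal
      = ∑ z with E z, ∏ i, ((p i).map φ (z i)).toReal := by
  have key : ∀ z : Fin n → Y, ∏ i, ((p i).map φ (z i)).toReal
      = ∑ y : Fin n → α with (fun i => φ (y i)) = z, ∏ i, (p i (y i)).toReal := by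
    intro z
    simp_rw [toReal_map_apply]
    rw [Finset.prod_univ_sum]
    refine Finset.sum_congr ?_ fun _ _ => rfl
    ext y
    simp [Fintype.mem_piFinset, funext_iff]
  simp_rw [key]
  symm
  convert Finset.sum_fiberwise_of_maps_to (s := {y : Fin n → α | E fun i => φ (y i)})
    (t := {z | E z}) (g := fun y i => φ (y i)) (fun y hy => by simpa using hy)
    (fun y => ∏ i, (p i (y i)).toReal) using 2 with z hz
  refine Finset.sum_congr ?_ fun _ _ => rfl
  ext y
  simp only [Finset.mem_filter, Finset.mem_univ, true_and, iff_and_self]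
  rintro rfl
  simpa using hz

end FiniteSums

section SingleLetter

variable {X Y : Type}

lemma continuous_mutualInfo [Fintype X] [Fintype Y] (V : X → PMF Y) :
    Continuous (mutualInfo V) := by
  unfold mutualInfo
  refine Continuous.sub ?_ (by fun_prop)
  exact continuous_finsetSum _ fun y _ => Real.continuous_negMulLog.comp (by fun_prop)

lemma mutualInfo_eq_sum [Fintype X] [Fintype Y] (V : X → PMF Y) (p : X → ℝ) :
    mutualInfo V p = ∑ x, p x * ∑ y, (V x y).toReal *
      (Real.log (V x y).toReal - Real.log (∑ x', p x' * (V x' y).toReal)) := by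
  have h : ∑ y, Real.negMulLog (∑ x, p x * (V x y).toReal) =
      - ∑ x, p x * ∑ y, (V x y).toReal * Real.log (∑ x', p x' * (V x' y).toReal) := by
    simp_rw [Finset.mul_sum]
    rw [Finset.sum_comm, ← Finset.sum_neg_distrib]
    refine Finset.sum_congr rfl fun y _ => ?_
    rw [Real.negMulLog, neg_mul, Finset.sum_mul]
    simp_rw [mul_assoc]
  unfold mutualInfo pmfEntropy
  rw [h]
  simp_rw [mul_sub, Finset.sum_sub_distrib, Real.negMulLog, neg_mul, Finset.sum_neg_distrib]
  simp_rw [mul_sub, Finset.sum_sub_distrib, mul_neg, Finset.sum_neg_distrib]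
  ring

lemma sum_letterFreq_mul {S : Type} [Fintype X] [Fintype S] {n : ℕ} (enc : S → Fin n → X)
    (d : X → ℝ) :
    ∑ x, letterFreq enc x * d x = (∑ s, ∑ i, d (enc s i)) / (Fintype.card S * n) := by
  simp_rw [letterFreq, div_mul_eq_mul_div, ← Finset.sum_div, Finset.sum_mul]
  congr 1
  rw [Finset.sum_comm]
  refine Finset.sum_congr rfl fun s _ => ?_
  rw [Finset.sum_comm]
  simp

lemma letterFreq_nonneg {S : Type} [Fintype S] {n : ℕ} (enc : S → Fin n → X) (x : X) :
    0 ≤ letterFreq enc x := by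
  unfold letterFreq
  positivity

lemma letterFreq_pos {S : Type} [Fintype S] {n : ℕ} (enc : S → Fin n → X) (s : S) (i : Fin n) :
    0 < letterFreq enc (enc s i) := by
  have : 0 < Fintype.card S := Fintype.card_pos_iff.2 ⟨s⟩
  have hn : 0 < n := i.pos
  refine div_pos ?_ (by positivity)
  refine Finset.sum_pos' (fun _ _ => by positivity) ⟨s, Finset.mem_univ _, ?_⟩
  exact Finset.sum_pos' (fun _ _ => by positivity) ⟨i, Finset.mem_univ _, by simp⟩

lemma letterFreq_mem_stdSimplex {S : Type} [Fintype X] [Fintype S] [Nonempty S] {n : ℕ}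
    (hn : 0 < n) (enc : S → Fin n → X) : letterFreq enc ∈ stdSimplex ℝ X := by
  refine ⟨letterFreq_nonneg enc, ?_⟩
  have h := sum_letterFreq_mul enc fun _ => 1
  have hS : (Fintype.card S : ℝ) ≠ 0 := by simp
  have hn' : (n : ℝ) ≠ 0 := by positivity
  simp only [mul_one, Finset.sum_const, Finset.card_univ, Fintype.card_fin, nsmul_eq_mul] at h
  rw [h, div_self (mul_ne_zero hS hn')]

end SingleLetter

/-- The elementary inequality `log t ≤ t / 2 - 1 + log 2` in the homogeneous form
`P (L - ℓ) ≤ K Q / 2 - P + P log 2`, where `L = log K` and `ℓ = log (P / Q)`. -/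
lemma mul_log_sub_le {P Q K : ℝ} (hP : 0 < P) (hQ : 0 < Q) (hK : 0 < K) :
    P * (Real.log K - (Real.log P - Real.log Q)) ≤ K * Q / 2 - P + P * Real.log 2 := by
  have h := Real.log_le_sub_one_of_pos (show 0 < K * Q / P / 2 by positivity)
  rw [Real.log_div (by positivity) (by positivity), Real.log_div (by positivity) (by positivity),
    Real.log_mul (by positivity) (by positivity)] at h
  have h2 := mul_le_mul_of_nonneg_left h hP.le
  have h3 : P * (K * Q / P / 2 - 1) = K * Q / 2 - P := by field_simp
  rw [h3] at h2
  linarith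

/-- **One-shot converse.**  If every output word is accepted by at most a fraction `1 / K` of
the messages and every message is accepted with probability at least `1 - ε`, then
`(1 - ε) log K - log 2` is at most `n` times the mutual information at the letter
frequencies of the code. -/
lemma converse_mutualInfo {S X Y : Type} [Fintype S] [Nonempty S] [Fintype X] [Fintype Y] {n : ℕ}
    (hn : 0 < n) (V : X → PMF Y) (enc : S → Fin n → X) (T : S → (Fin n → Y) → Prop)
    {K ε : ℝ} (hK : 1 ≤ K)
    (hT : ∀ z (F : Finset S), (∀ s ∈ F, T s z) → F.card * K ≤ Fintype.card S)
    (hε : ∀ s, 1 - ε ≤ ∑ z with T s z, ∏ i, (V (enc s i) (z i)).toReal) :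
    (1 - ε) * Real.log K - Real.log 2 ≤ n * mutualInfo V (letterFreq enc) := by
  have hS : (0 : ℝ) < Fintype.card S := by exact_mod_cast Fintype.card_pos
  have hn' : (0 : ℝ) < n := by exact_mod_cast hn
  have hK0 : 0 < K := by linarith
  set Q : Y → ℝ := fun y => ∑ x, letterFreq enc x * (V x y).toReal
  set ℓ : X → Y → ℝ := fun x y => Real.log (V x y).toReal - Real.log (Q y)
  have hQ0 : ∀ y, 0 ≤ Q y := fun y =>
    Finset.sum_nonneg fun x _ => mul_nonneg (letterFreq_nonneg _ _) ENNReal.toReal_nonneg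
  have hQ1 : ∑ y, Q y = 1 := by
    rw [Finset.sum_comm]
    simp_rw [← Finset.mul_sum, sum_toReal_pmf, mul_one]
    exact (letterFreq_mem_stdSimplex hn enc).2
  have hQpos : ∀ s i y, 0 < (V (enc s i) y).toReal → 0 < Q y := fun s i y hy =>
    Finset.sum_pos' (fun x _ => mul_nonneg (letterFreq_nonneg _ _) ENNReal.toReal_nonneg)
      ⟨enc s i, Finset.mem_univ _, mul_pos (letterFreq_pos enc s i) hy⟩
  set P : S → (Fin n → Y) → ℝ := fun s z => ∏ i, (V (enc s i) (z i)).toReal with hP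
  have hP1 : ∀ s, ∑ z, P s z = 1 := fun s =>
    sum_prod_eq_one (fun i y => (V (enc s i) y).toReal) fun i => sum_toReal_pmf _
  have hQn1 : ∑ z : Fin n → Y, ∏ i, Q (z i) = 1 := sum_prod_eq_one (fun _ => Q) fun _ => hQ1
  have pointwise : ∀ s z, (if T s z then P s z else 0) * Real.log K
        - P s z * ∑ i, ℓ (enc s i) (z i)
      ≤ (∏ i, Q (z i)) / 2 + (if T s z then 1 else 0) * (K * ∏ i, Q (z i)) / 2
        - P s z + P s z * Real.log 2 := by
    intro s z
    have hQn0 : 0 ≤ ∏ i, Q (z i) := Finset.prod_nonneg fun i _ => hQ0 _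
    have hKQ : 0 ≤ K * ∏ i, Q (z i) := mul_nonneg hK0.le hQn0
    have hP0 : 0 ≤ P s z := Finset.prod_nonneg fun i _ => ENNReal.toReal_nonneg
    rcases hP0.eq_or_lt with h0 | hpos
    · rw [← h0]
      split_ifs <;> nlinarith
    · have hVpos : ∀ i, 0 < (V (enc s i) (z i)).toReal := fun i =>
        lt_of_le_of_ne ENNReal.toReal_nonneg fun h =>
          hpos.ne' (Finset.prod_eq_zero (Finset.mem_univ i) h.symm)
      have hQi : ∀ i, 0 < Q (z i) := fun i => hQpos s i _ (hVpos i)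
      have hQn : 0 < ∏ i, Q (z i) := Finset.prod_pos fun i _ => hQi i
      have hlog : ∑ i, ℓ (enc s i) (z i) = Real.log (P s z) - Real.log (∏ i, Q (z i)) := by
        rw [hP, Real.log_prod fun i _ => (hVpos i).ne', Real.log_prod fun i _ => (hQi i).ne',
          ← Finset.sum_sub_distrib]
      rw [hlog]
      split_ifs
      · have := mul_log_sub_le hpos hQn hK0
        linarith
      · have := mul_log_sub_le hpos hQn one_pos
        rw [Real.log_one] at this
        linarith
  have lhs_info : ∑ s, ∑ z, P s z * ∑ i, ℓ (enc s i) (z i)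
      = Fintype.card S * (n * mutualInfo V (letterFreq enc)) := by
    rw [mutualInfo_eq_sum, sum_letterFreq_mul enc fun x => ∑ y, (V x y).toReal * ℓ x y,
      ← mul_assoc, mul_div_cancel₀ _ (by positivity)]
    refine Finset.sum_congr rfl fun s _ => ?_
    simp_rw [Finset.mul_sum]
    rw [Finset.sum_comm]
    exact Finset.sum_congr rfl fun i _ =>
      sum_prod_mul_apply (fun i y => (V (enc s i) y).toReal) (fun i => sum_toReal_pmf _) i
        (ℓ (enc s i))
  have accept : Fintype.card S * ((1 - ε) * Real.log K)
      ≤ ∑ s, ∑ z, (if T s z then P s z else 0) * Real.log K := by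
    rw [← nsmul_eq_mul, ← Finset.card_univ]
    refine Finset.card_nsmul_le_sum _ _ _ fun s _ => ?_
    rw [← Finset.sum_mul, ← Finset.sum_filter]
    exact mul_le_mul_of_nonneg_right (hε s) (Real.log_nonneg hK)
  have guess : ∑ s, ∑ z, (if T s z then 1 else 0) * (K * ∏ i, Q (z i)) / 2
      ≤ Fintype.card S / 2 := by
    rw [Finset.sum_comm]
    calc ∑ z, ∑ s, (if T s z then 1 else 0) * (K * ∏ i, Q (z i)) / 2
        ≤ ∑ z : Fin n → Y, (∏ i, Q (z i)) * (Fintype.card S / 2) := by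
          refine Finset.sum_le_sum fun z _ => ?_
          rw [← Finset.sum_div, ← Finset.sum_mul, Finset.sum_boole]
          have := mul_le_mul_of_nonneg_left (hT z (Finset.univ.filter fun s => T s z)
            fun s hs => (Finset.mem_filter.1 hs).2)
            (Finset.prod_nonneg fun i _ => hQ0 (z i) : 0 ≤ ∏ i, Q (z i))
          linarith
      _ = Fintype.card S / 2 := by rw [← Finset.sum_mul, hQn1, one_mul]
  have total := Finset.sum_le_sum fun s (_ : s ∈ Finset.univ) =>
    Finset.sum_le_sum fun z (_ : z ∈ Finset.univ) => pointwise s z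
  simp_rw [Finset.sum_add_distrib, Finset.sum_sub_distrib, Finset.sum_add_distrib,
    ← Finset.sum_mul (Finset.univ : Finset (Fin n → Y)) (P _) (Real.log 2), hP1] at total
  simp only [← Finset.sum_div _ (fun z : Fin n → Y => ∏ i, Q (z i)), hQn1, Finset.sum_const,
    Finset.card_univ, nsmul_eq_mul] at total
  rw [lhs_info] at total
  refine le_of_mul_le_mul_left ?_ hS
  linarith

section Degenerate

lemma map_fun_const {α β : Type} (p : PMF α) (b : β) : (p.map fun _ => b) = PMF.pure b :=
  PMF.map_const p b

lemma pmfEntropy_map_of_injective {α β : Type} [Fintype α] [Fintype β] (p : PMF α) {φ : α → β}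
    (hφ : Function.Injective φ) : pmfEntropy (p.map φ) = pmfEntropy p := by
  unfold pmfEntropy
  symm
  refine Finset.sum_of_injOn φ hφ.injOn (fun _ _ => Finset.mem_coe.2 (Finset.mem_univ _)) ?_ ?_
  · intro b _ hb
    rw [toReal_map_apply, Finset.sum_eq_zero, Real.negMulLog_zero]
    intro a ha
    exact absurd ⟨a, by simp, (Finset.mem_filter.1 ha).2⟩ hb
  · intro a _
    rw [toReal_map_apply, Finset.sum_eq_single a]
    · intro a' ha' hne
      exact absurd (hφ (Finset.mem_filter.1 ha').2) hne
    · simp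

lemma pmfEntropy_pure {α : Type} [Fintype α] (a : α) : pmfEntropy (PMF.pure a) = 0 := by
  unfold pmfEntropy
  refine Finset.sum_eq_zero fun b _ => ?_
  by_cases h : b = a <;> simp [PMF.pure_apply, h]

/-- A constant auxiliary variable turns conditional mutual information into mutual
information. -/
lemma condMI_const {U X Y : Type} [Fintype U] [Fintype X] [Fintype Y] (V : X → PMF Y)
    (p : PMF X) (u : U) :
    condMI (p.bind fun x => (V x).map fun y => (u, x, y))
      = mutualInfo V fun x => (p x).toReal := by
  set J : PMF (X × Y) := p.bind fun x => (V x).map fun y => (x, y) with hJ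
  have hJmap : (p.bind fun x => (V x).map fun y => (u, x, y)) = J.map fun z => (u, z) := by
    simp [hJ, PMF.map_bind, PMF.map_comp, Function.comp_def]
  have hJ_apply : ∀ x y, (J (x, y)).toReal = (p x).toReal * (V x y).toReal := by
    intro x y
    rw [hJ, PMF.bind_apply, tsum_fintype, Finset.sum_eq_single x]
    · rw [ENNReal.toReal_mul, toReal_map_apply]
      congr 1
      rw [Finset.sum_eq_single y] <;> simp +contextual
    · intro x' _ hx'
      refine mul_eq_zero_of_right _ ((PMF.apply_eq_zero_iff _ _).2 ?_)
      simp [hx']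
    · simp
  have hfst : J.map Prod.fst = p := by
    simp [hJ, PMF.map_bind, PMF.map_comp, Function.comp_def, map_fun_const]
  have hsnd : ∀ y, ((J.map Prod.snd) y).toReal = ∑ x, (p x).toReal * (V x y).toReal := by
    intro y
    rw [toReal_map_apply, Finset.sum_filter, Fintype.sum_prod_type]
    simp [hJ_apply]
  have hHJ : pmfEntropy J = pmfEntropy p + ∑ x, (p x).toReal * pmfEntropy (V x) := by
    unfold pmfEntropy
    rw [Fintype.sum_prod_type, ← Finset.sum_add_distrib]
    refine Finset.sum_congr rfl fun x _ => ?_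
    simp_rw [hJ_apply, Real.negMulLog_mul, Finset.sum_add_distrib]
    rw [← Finset.sum_mul, ← Finset.mul_sum, sum_toReal_pmf, one_mul]
  have e1 : (J.map fun z => (u, z)).map (fun z => (z.1, z.2.1)) = p.map fun x => (u, x) := by
    rw [← hfst]; simp [PMF.map_comp, Function.comp_def]
  have e2 : (J.map fun z => (u, z)).map (fun z => (z.1, z.2.2))
      = (J.map Prod.snd).map fun y => (u, y) := by
    simp [PMF.map_comp, Function.comp_def]
  have e3 : (J.map fun z => (u, z)).map Prod.fst = PMF.pure u := by
    simp [PMF.map_comp, Function.comp_def, map_fun_const]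
  rw [hJmap, condMI, e1, e2, e3, pmfEntropy_pure,
    pmfEntropy_map_of_injective _ (Prod.mk_right_injective u),
    pmfEntropy_map_of_injective _ (Prod.mk_right_injective u),
    pmfEntropy_map_of_injective _ (Prod.mk_right_injective u), hHJ, mutualInfo]
  unfold pmfEntropy
  simp_rw [hsnd]
  ring

end Degenerate

lemma exists_pmf_of_mem_stdSimplex {X : Type} [Fintype X] {p : X → ℝ} (hp : p ∈ stdSimplex ℝ X) :
    ∃ P : PMF X, ∀ x, (P x).toReal = p x := by
  refine ⟨PMF.ofFintype (fun x => ENNReal.ofReal (p x)) ?_, fun x => ?_⟩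
  · rw [← ENNReal.ofReal_sum_of_nonneg fun x _ => hp.1 x, hp.2, ENNReal.ofReal_one]
  · rw [PMF.ofFintype_apply, ENNReal.toReal_ofReal (hp.1 x)]

/-- A decoder that knows `a s` and outputs `b s` is correct on at most one message for each
value of its side information. -/
lemma card_le_of_decodes {S A B : Type} [Fintype A] (F : Finset S) (a : S → A) (b : S → B)
    (hab : Function.Injective fun s => (a s, b s)) (g : A → Option B)
    (hg : ∀ s ∈ F, g (a s) = some (b s)) : F.card ≤ Fintype.card A := by
  refine Finset.card_le_card_of_injOn a (fun _ _ => by simp) fun s hs t ht hst => hab ?_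
  have h := (hg s hs).symm.trans ((congrArg g hst).trans (hg t ht))
  exact Prod.ext hst (Option.some_injective _ h)

section Codes

variable [Fintype 𝒴₁] [Fintype 𝒴₂]

lemma one_sub_prodProb_ne {Y : Type} [Fintype Y] (W : 𝒳 → PMF (𝒴₁ × 𝒴₂)) {n : ℕ}
    (x : Fin n → 𝒳) (φ : 𝒴₁ × 𝒴₂ → Y) (E : (Fin n → Y) → Prop) :
    1 - prodProb W x (fun y => ¬ E fun i => φ (y i))
      = ∑ z with E z, ∏ i, ((W (x i)).map φ (z i)).toReal := by
  rw [← sum_prod_map, prodProb,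
    ← sum_prod_eq_one (fun i y => (W (x i) y).toReal) (fun i => sum_toReal_pmf _),
    sub_eq_iff_eq_add]
  convert (Finset.sum_filter_add_sum_filter_not Finset.univ
    (fun y : Fin n → 𝒴₁ × 𝒴₂ => E fun i => φ (y i)) _).symm

lemma converse_receiver₁ [Fintype 𝒳] (W : 𝒳 → PMF (𝒴₁ × 𝒴₂)) {M₁ M₂ n : ℕ} (hn : 0 < n)
    (hM₁ : 1 ≤ M₁) (hM₂ : 1 ≤ M₂) (c : Code 𝒳 𝒴₁ 𝒴₂ M₁ M₂ n) :
    (1 - maxErr₁ W c) * Real.log M₂ - Real.log 2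
      ≤ n * mutualInfo (fun x => (W x).map Prod.fst) (letterFreq c.enc) := by
  have : NeZero M₁ := ⟨by omega⟩
  have : NeZero M₂ := ⟨by omega⟩
  refine converse_mutualInfo hn _ c.enc (fun v z => c.dec₁ (z, v.1) = some v.2)
    (by exact_mod_cast hM₂) (fun z F hF => ?_) fun v => ?_
  · rw [Fintype.card_prod, Fintype.card_fin, Fintype.card_fin]
    norm_cast
    refine Nat.mul_le_mul_right M₂ ?_
    exact (card_le_of_decodes _ Prod.fst Prod.snd Function.injective_id (fun w => c.dec₁ (z, w)) hF).trans_eq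
      (Fintype.card_fin M₁)
  · rw [← one_sub_prodProb_ne]
    exact sub_le_sub_left (le_ciSup (f := fun v => err₁ W c v) (Set.finite_range _).bddAbove v) 1

lemma converse_receiver₂ [Fintype 𝒳] (W : 𝒳 → PMF (𝒴₁ × 𝒴₂)) {M₁ M₂ n : ℕ} (hn : 0 < n)
    (hM₁ : 1 ≤ M₁) (hM₂ : 1 ≤ M₂) (c : Code 𝒳 𝒴₁ 𝒴₂ M₁ M₂ n) :
    (1 - maxErr₂ W c) * Real.log M₁ - Real.log 2
      ≤ n * mutualInfo (fun x => (W x).map Prod.snd) (letterFreq c.enc) := by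
  have : NeZero M₁ := ⟨by omega⟩
  have : NeZero M₂ := ⟨by omega⟩
  refine converse_mutualInfo hn _ c.enc (fun v z => c.dec₂ (z, v.2) = some v.1)
    (by exact_mod_cast hM₁) (fun z F hF => ?_) fun v => ?_
  · rw [Fintype.card_prod, Fintype.card_fin, Fintype.card_fin, Nat.mul_comm M₁]
    norm_cast
    refine Nat.mul_le_mul_right M₁ ?_
    exact (card_le_of_decodes _ Prod.snd Prod.fst Prod.swap_injective (fun w => c.dec₂ (z, w)) hF).trans_eq
      (Fintype.card_fin M₂)
  · rw [← one_sub_prodProb_ne]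
    exact sub_le_sub_left (le_ciSup (f := fun v => err₂ W c v) (Set.finite_range _).bddAbove v) 1

end Codes

/-- If `(1 - εₙ) Lₙ - log 2 ≤ n Iₙ` with `εₙ → 0` and `Lₙ / n ≥ R - δ` eventually, then
eventually `Iₙ ≥ R - 2 δ`. -/
lemma eventually_rate_le {R δ : ℝ} (hδ : 0 < δ) {L I ε : ℕ → ℝ}
    (hε : Filter.Tendsto ε Filter.atTop (nhds 0))
    (hL : ∀ᶠ n : ℕ in Filter.atTop, R - δ ≤ L n / n)
    (hI : ∀ᶠ n : ℕ in Filter.atTop, (1 - ε n) * L n - Real.log 2 ≤ n * I n) :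
    ∀ᶠ n : ℕ in Filter.atTop, R - 2 * δ ≤ I n := by
  have lim : Filter.Tendsto (fun n : ℕ => (1 - ε n) * (R - δ) - Real.log 2 / n) Filter.atTop
      (nhds ((1 - 0) * (R - δ) - 0)) :=
    ((tendsto_const_nhds.sub hε).mul_const _).sub (tendsto_const_div_atTop_nhds_zero_nat _)
  have hlim := lim.eventually (lt_mem_nhds (show R - 2 * δ < (1 - 0) * (R - δ) - 0 by linarith))
  have hε1 := hε.eventually (gt_mem_nhds one_pos)
  filter_upwards [hlim, hε1, hL, hI, Filter.eventually_gt_atTop 0] with n h1 h2 h3 h4 hn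
  have hn' : (0 : ℝ) < n := by exact_mod_cast hn
  have h5 : (1 - ε n) * (R - δ) ≤ (1 - ε n) * (L n / n) :=
    mul_le_mul_of_nonneg_left h3 (by linarith)
  have h6 : (1 - ε n) * (L n / n) - Real.log 2 / n ≤ I n := by
    rw [← mul_div_assoc, ← sub_div, div_le_iff₀ hn']
    linarith
  linarith

/-- **Weak converse and cardinality bound for the bidirectional broadcast channel**:
every achievable rate pair `(R₂, R₁)` (rates approached with maximum error
probabilities tending to `0`) lies in the information region `𝒞`, and the auxiliary
alphabet can be taken to be `Fin 2`. -/
theorem weakConverse [Fintype 𝒳] [Nonempty 𝒳] [Fintype 𝒴₁] [Nonempty 𝒴₁]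
    [Fintype 𝒴₂] [Nonempty 𝒴₂]
    (W : 𝒳 → PMF (𝒴₁ × 𝒴₂)) (R₂ R₁ : ℝ) (hR₂ : 0 ≤ R₂) (hR₁ : 0 ≤ R₁)
    (hach : ∀ δ : ℝ, 0 < δ →
      ∃ (N : ℕ) (M₁ M₂ : ℕ → ℕ) (c : ∀ n, Code 𝒳 𝒴₁ 𝒴₂ (M₁ n) (M₂ n) n),
        (∀ n, 1 ≤ M₁ n ∧ 1 ≤ M₂ n) ∧
        (∀ n, N ≤ n → R₂ - δ ≤ Real.log (M₁ n) / n ∧ R₁ - δ ≤ Real.log (M₂ n) / n) ∧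
        Filter.Tendsto (fun n => maxErr₁ W (c n)) Filter.atTop (nhds 0) ∧
        Filter.Tendsto (fun n => maxErr₂ W (c n)) Filter.atTop (nhds 0)) :
    (R₂, R₁) ∈ infoRegion W ∧
      ∃ q : PMF (Fin 2 × 𝒳),
        R₂ ≤ condMI (joint₂ W q) ∧ R₁ ≤ condMI (joint₁ W q) := by
  set I₁ := mutualInfo fun x => (W x).map Prod.fst
  set I₂ := mutualInfo fun x => (W x).map Prod.snd
  have approx : ∀ δ : ℝ, 0 < δ →
      ∃ p ∈ stdSimplex ℝ 𝒳, R₂ - 2 * δ ≤ I₂ p ∧ R₁ - 2 * δ ≤ I₁ p := by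
    intro δ hδ
    obtain ⟨N, M₁, M₂, c, hM, hrate, he₁, he₂⟩ := hach δ hδ
    have hN := Filter.eventually_ge_atTop N
    have hpos := Filter.eventually_gt_atTop 0
    have h₂ := eventually_rate_le hδ he₂ (hN.mono fun n hn => (hrate n hn).1)
      (hpos.mono fun n hn => converse_receiver₂ W hn (hM n).1 (hM n).2 (c n))
    have h₁ := eventually_rate_le hδ he₁ (hN.mono fun n hn => (hrate n hn).2)
      (hpos.mono fun n hn => converse_receiver₁ W hn (hM n).1 (hM n).2 (c n))
    obtain ⟨n, h₂n, h₁n, hn⟩ := (h₂.and (h₁.and hpos)).exists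
    have : NeZero (M₁ n) := ⟨by have := (hM n).1; omega⟩
    have : NeZero (M₂ n) := ⟨by have := (hM n).2; omega⟩
    exact ⟨_, letterFreq_mem_stdSimplex hn (c n).enc, h₂n, h₁n⟩
  obtain ⟨p, hp, hmax⟩ : ∃ p ∈ stdSimplex ℝ 𝒳,
      IsMaxOn (fun p => min (I₂ p - R₂) (I₁ p - R₁)) (stdSimplex ℝ 𝒳) p := by
    obtain ⟨p₀, hp₀, -⟩ := approx 1 one_pos
    exact (isCompact_stdSimplex (𝕜 := ℝ) 𝒳).exists_isMaxOn ⟨p₀, hp₀⟩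
      (((continuous_mutualInfo _).sub continuous_const).min
        ((continuous_mutualInfo _).sub continuous_const)).continuousOn
  have hnonneg : 0 ≤ min (I₂ p - R₂) (I₁ p - R₁) := by
    refine le_of_forall_pos_le_add fun η hη => ?_
    obtain ⟨r, hr, h₂, h₁⟩ := approx (η / 2) (half_pos hη)
    have hle : min (I₂ r - R₂) (I₁ r - R₁) ≤ min (I₂ p - R₂) (I₁ p - R₁) := hmax hr
    have : -η ≤ min (I₂ r - R₂) (I₁ r - R₁) := le_min (by linarith) (by linarith)
    linarith
  obtain ⟨P, hP⟩ := exists_pmf_of_mem_stdSimplex hp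
  have hPp : (fun x => (P x).toReal) = p := funext hP
  have joint_mutualInfo : R₂ ≤ condMI (joint₂ W (P.map fun x => ((0 : Fin 2), x))) ∧
      R₁ ≤ condMI (joint₁ W (P.map fun x => ((0 : Fin 2), x))) := by
    have e₂ := condMI_const (fun x => (W x).map Prod.snd) P (0 : Fin 2)
    have e₁ := condMI_const (fun x => (W x).map Prod.fst) P (0 : Fin 2)
    simp only [PMF.map_comp, Function.comp_def, hPp] at e₁ e₂
    simp only [joint₁, joint₂, PMF.bind_map, Function.comp_def]
    rw [e₁, e₂]
    exact ⟨by linarith [(le_min_iff.1 hnonneg).1], by linarith [(le_min_iff.1 hnonneg).2]⟩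
  exact ⟨⟨hR₂, hR₁, Fin 2, inferInstance, _, joint_mutualInfo⟩, _, joint_mutualInfo⟩

end BDBC
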